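/- The set {z ∈ ℂ | conj(z) · (z³ − 1/8) = z² − 1/1000} is finite and has exactly 10 elements. -/

import Mathlib

open Polynomial in
/-- A nonzero real polynomial of degree at most `n` whose values change sign `n` times along an
increasing sequence has exactly `n` real zeros. -/
theorem Polynomial.finite_and_ncard_of_sign_changes {n : ℕ} {p : ℝ[X]} (hp : p ≠ 0)
    (hdeg : p.natDegree ≤ n) {a : Fin (n + 1) → ℝ} (ha : StrictMono a)
    (hsign : ∀ i : Fin n, p.eval (a i.castSucc) * p.eval (a i.succ) < 0) :
    {x | p.eval x = 0}.Finite ∧ {x | p.eval x = 0}.ncard = n := by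
  have hroots : {x | p.eval x = 0} = p.rootSet ℝ := by
    ext x
    simp [mem_rootSet, hp]
  have hfin : {x | p.eval x = 0}.Finite := hroots ▸ p.rootSet_finite ℝ
  refine ⟨hfin, le_antisymm ?_ ?_⟩
  · rw [hroots]
    exact (p.ncard_rootSet_le ℝ).trans hdeg
  have hex (i : Fin n) : ∃ x ∈ Set.Ioo (a i.castSucc) (a i.succ), p.eval x = 0 := by
    have hle : a i.castSucc ≤ a i.succ := (ha i.castSucc_lt_succ).le
    rcases mul_neg_iff.mp (hsign i) with h | h
    · exact intermediate_value_Ioo' hle p.continuous.continuousOn ⟨h.2, h.1⟩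
    · exact intermediate_value_Ioo hle p.continuous.continuousOn h
  choose x hx hx0 using hex
  have hmono : StrictMono x := fun i j hij =>
    (hx i).2.trans_le ((ha.monotone (Fin.succ_le_castSucc_iff.mpr hij)).trans (hx j).1.le)
  calc n = (Set.range x).ncard := by
        rw [← Set.image_univ, Set.ncard_image_of_injective _ hmono.injective, Set.ncard_univ,
          Nat.card_fin]
    _ ≤ _ := Set.ncard_le_ncard (Set.range_subset_iff.mpr hx0) hfin

/-- The abscissas of the real solutions of the lens equation. -/
theorem lens_real_abscissas :
    {x : ℝ | x ^ 4 - x ^ 2 - x / 8 + 1 / 1000 = 0}.Finite ∧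
      {x : ℝ | x ^ 4 - x ^ 2 - x / 8 + 1 / 1000 = 0}.ncard = 4 := by
  open Polynomial in
  let p : ℝ[X] := X ^ 4 - X ^ 2 - C (1 / 8) * X + C (1 / 1000)
  have hdeg : p.natDegree = 4 := by unfold p; compute_degree!
  have heval (x : ℝ) : p.eval x = x ^ 4 - x ^ 2 - x / 8 + 1 / 1000 := by
    simp [p]; ring
  have ha : StrictMono ![(-1 : ℝ), -1 / 2, 0, 1 / 2, 2] := by
    rw [Fin.strictMono_iff_lt_succ]
    intro i
    fin_cases i <;> simp <;> norm_num
  simp only [← heval]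
  refine p.finite_and_ncard_of_sign_changes (by rintro h; simp [h] at hdeg) hdeg.le ha fun i => ?_
  rw [heval, heval]
  fin_cases i <;> simp <;> norm_num

/-- The abscissas of the non-real solutions of the lens equation. -/
theorem lens_nonreal_abscissas :
    {x : ℝ | 8 * x ^ 3 - 4 * x ^ 2 / 125 - 2 * x + 1 / 8 = 0}.Finite ∧
      {x : ℝ | 8 * x ^ 3 - 4 * x ^ 2 / 125 - 2 * x + 1 / 8 = 0}.ncard = 3 := by
  open Polynomial in
  let p : ℝ[X] := C 8 * X ^ 3 - C (4 / 125) * X ^ 2 - C 2 * X + C (1 / 8)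
  have hdeg : p.natDegree = 3 := by unfold p; compute_degree!
  have heval (x : ℝ) : p.eval x = 8 * x ^ 3 - 4 * x ^ 2 / 125 - 2 * x + 1 / 8 := by
    simp [p]; ring
  have ha : StrictMono ![(-1 : ℝ), 0, 1 / 4, 1] := by
    rw [Fin.strictMono_iff_lt_succ]
    intro i
    fin_cases i <;> simp
    norm_num
  simp only [← heval]
  refine p.finite_and_ncard_of_sign_changes (by rintro h; simp [h] at hdeg) hdeg.le ha fun i => ?_
  rw [heval, heval]
  fin_cases i <;> simp <;> norm_num

theorem lens_nonreal_ordinate_sq_pos {x : ℝ}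
    (hx : 8 * x ^ 3 - 4 * x ^ 2 / 125 - 2 * x + 1 / 8 = 0) :
    0 < 3 * x ^ 2 - 2 * x / 125 := by
  rcases lt_or_ge x 0 with h | h
  · nlinarith [sq_nonneg x]
  · have : 2 / 375 < x := by
      by_contra! h'
      nlinarith [pow_nonneg h 3]
    nlinarith

/-- The lens equation in real coordinates. -/
theorem lens_equation_iff (z : ℂ) :
    (starRingEnd ℂ z) * (z ^ 3 - 1 / 8) = z ^ 2 - 1 / 1000 ↔
      (z.im = 0 ∧ z.re ^ 4 - z.re ^ 2 - z.re / 8 + 1 / 1000 = 0) ∨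
      (8 * z.re ^ 3 - 4 * z.re ^ 2 / 125 - 2 * z.re + 1 / 8 = 0 ∧
        z.im ^ 2 = 3 * z.re ^ 2 - 2 * z.re / 125) := by
  obtain ⟨x, y⟩ := z
  have hcoord : (starRingEnd ℂ ⟨x, y⟩) * ((⟨x, y⟩ : ℂ) ^ 3 - 1 / 8) = ⟨x, y⟩ ^ 2 - 1 / 1000 ↔
      (x ^ 2 - y ^ 2) * (x ^ 2 + y ^ 2 - 1) = x / 8 - 1 / 1000 ∧
        y * (2 * x * (x ^ 2 + y ^ 2 - 1) + 1 / 8) = 0 := by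
    have h8 : (1 / 8 : ℂ) = ⟨1 / 8, 0⟩ := by apply Complex.ext <;> norm_num
    have h1000 : (1 / 1000 : ℂ) = ⟨1 / 1000, 0⟩ := by apply Complex.ext <;> norm_num
    rw [h8, h1000, Complex.ext_iff]
    simp only [pow_succ, pow_zero, one_mul, Complex.mul_re, Complex.mul_im, Complex.sub_re,
      Complex.sub_im, Complex.conj_re, Complex.conj_im]
    constructor <;> rintro ⟨h₁, h₂⟩
    · exact ⟨by linear_combination h₁, by linear_combination h₂⟩
    · exact ⟨by linear_combination h₁, by linear_combination h₂⟩
  rw [hcoord]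
  constructor
  · rintro ⟨h₁, h₂⟩
    rcases mul_eq_zero.mp h₂ with rfl | h
    · exact .inl ⟨rfl, by linear_combination h₁⟩
    · have hy : y ^ 2 = 3 * x ^ 2 - 2 * x / 125 := by
        linear_combination 16 * x * h₁ - 8 * (x ^ 2 - y ^ 2) * h
      exact .inr ⟨by linear_combination h - 2 * x * hy, hy⟩
  · rintro (⟨rfl, h⟩ | ⟨hx, hy⟩)
    · exact ⟨by linear_combination h, by ring⟩
    · have h : 2 * x * (x ^ 2 + y ^ 2 - 1) + 1 / 8 = 0 := by
        linear_combination hx + 2 * x * hy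
      have hx0 : x ≠ 0 := by
        rintro rfl
        norm_num at hx
      refine ⟨mul_left_cancel₀ hx0 ?_, by rw [h, mul_zero]⟩
      linear_combination (x ^ 2 - y ^ 2) / 2 * h + hy / 16

/-- The lens equation `conj(z) (z³ - 1/8) = z² - 1/1000` has exactly 10
solutions. -/
theorem stmt_9 :
    ({z : ℂ | (starRingEnd ℂ z) * (z ^ 3 - 1 / 8) = z ^ 2 - 1 / 1000}).Finite ∧
    ({z : ℂ | (starRingEnd ℂ z) * (z ^ 3 - 1 / 8) = z ^ 2 - 1 / 1000}).ncard = 10 := by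
  obtain ⟨hRfin, hRcard⟩ := lens_real_abscissas
  obtain ⟨hTfin, hTcard⟩ := lens_nonreal_abscissas
  set R := {x : ℝ | x ^ 4 - x ^ 2 - x / 8 + 1 / 1000 = 0}
  set T := {x : ℝ | 8 * x ^ 3 - 4 * x ^ 2 / 125 - 2 * x + 1 / 8 = 0}
  let y (x : ℝ) : ℝ := √(3 * x ^ 2 - 2 * x / 125)
  have hypos {x : ℝ} (hx : x ∈ T) : 0 < y x := Real.sqrt_pos.mpr (lens_nonreal_ordinate_sq_pos hx)
  have hysq {x : ℝ} (hx : x ∈ T) : y x ^ 2 = 3 * x ^ 2 - 2 * x / 125 :=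
    Real.sq_sqrt (lens_nonreal_ordinate_sq_pos hx).le
  let A : Set ℂ := (fun x : ℝ => ⟨x, 0⟩) '' R
  let B : Set ℂ := (fun x : ℝ => ⟨x, y x⟩) '' T
  let C : Set ℂ := (fun x : ℝ => ⟨x, -y x⟩) '' T
  have hinj (f : ℝ → ℝ) : Function.Injective (fun x : ℝ => (⟨x, f x⟩ : ℂ)) :=
    fun _ _ h => congrArg Complex.re h
  have hA : A.Finite ∧ A.ncard = 4 :=
    ⟨hRfin.image _, (Set.ncard_image_of_injective R (hinj fun _ => 0)).trans hRcard⟩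
  have hB : B.Finite ∧ B.ncard = 3 :=
    ⟨hTfin.image _, (Set.ncard_image_of_injective T (hinj y)).trans hTcard⟩
  have hC : C.Finite ∧ C.ncard = 3 :=
    ⟨hTfin.image _, (Set.ncard_image_of_injective T (hinj fun x => -y x)).trans hTcard⟩
  have hAim : ∀ z ∈ A, z.im = 0 := by rintro _ ⟨x, -, rfl⟩; rfl
  have hBim : ∀ z ∈ B, 0 < z.im := by rintro _ ⟨x, hx, rfl⟩; exact hypos hx
  have hCim : ∀ z ∈ C, z.im < 0 := by rintro _ ⟨x, hx, rfl⟩; exact neg_lt_zero.mpr (hypos hx)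
  have hAB : Disjoint A B :=
    Set.disjoint_left.mpr fun z hz hz' => (hBim z hz').ne' (hAim z hz)
  have hABC : Disjoint (A ∪ B) C := by
    refine Set.disjoint_left.mpr fun z hz hz' => (hCim z hz').not_ge ?_
    exact hz.elim (fun h => (hAim z h).ge) fun h => (hBim z h).le
  have hset : {z : ℂ | (starRingEnd ℂ z) * (z ^ 3 - 1 / 8) = z ^ 2 - 1 / 1000} = A ∪ B ∪ C := by
    ext z
    rw [Set.mem_ofPred_eq, lens_equation_iff]
    constructor
    · rintro (⟨hy, hx⟩ | ⟨hx, hy⟩)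
      · exact .inl (.inl ⟨z.re, hx, Complex.ext rfl hy.symm⟩)
      · rcases sq_eq_sq_iff_eq_or_eq_neg.mp (hy.trans (hysq hx).symm) with h | h
        · exact .inl (.inr ⟨z.re, hx, Complex.ext rfl h.symm⟩)
        · exact .inr ⟨z.re, hx, Complex.ext rfl h.symm⟩
    · rintro ((⟨x, hx, rfl⟩ | ⟨x, hx, rfl⟩) | ⟨x, hx, rfl⟩)
      · exact .inl ⟨rfl, hx⟩
      · exact .inr ⟨hx, hysq hx⟩
      · exact .inr ⟨hx, (neg_sq _).trans (hysq hx)⟩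
  rw [hset]
  refine ⟨(hA.1.union hB.1).union hC.1, ?_⟩
  rw [Set.ncard_union_eq hABC (hA.1.union hB.1) hC.1, Set.ncard_union_eq hAB hA.1 hB.1, hA.2, hB.2,
    hC.2]
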